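/- arXiv:2109.11882 — 2 statements merged into one kernel-verified Lean document; each statement's English description precedes it below -/
import Mathlib

section
/- If an antinorm f on the positive orthant ℝ^d₊ is continuous, then it is reflexive: f**(x) = f(x) for all x ∈ ℝ^d₊. -/
open scoped BigOperators

noncomputable section

/-- The positive orthant in `ℝ^d`. -/
def pos (d : ℕ) : Set (Fin d → ℝ) := {x | ∀ i, 0 ≤ x i}

/-- Euclidean inner product of two vectors. -/
def dot {d : ℕ} (p x : Fin d → ℝ) : ℝ := ∑ i, p i * x i

/-- An antinorm on the positive orthant: nonnegative, positively homogeneous,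
concave and strictly positive somewhere. -/
def IsAntinorm {d : ℕ} (f : (Fin d → ℝ) → ℝ) : Prop :=
  (∀ x ∈ pos d, 0 ≤ f x) ∧
  (∀ x ∈ pos d, ∀ l : ℝ, 0 ≤ l → f (l • x) = l * f x) ∧
  ConcaveOn ℝ (pos d) f ∧
  ∃ x ∈ pos d, 0 < f x

/-- The dual antinorm `f*(p) = inf {⟨p,x⟩/f(x) : x ∈ ℝ^d₊, f(x) ≠ 0}`. -/
def dualAntinorm {d : ℕ} (f : (Fin d → ℝ) → ℝ) (p : Fin d → ℝ) : ℝ :=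
  sInf ((fun x => dot p x / f x) '' {x | x ∈ pos d ∧ f x ≠ 0})

/-- The dual functional satisfies the inequality `f*(p) f(x) ≤ ⟨p, x⟩`. -/
theorem dualAntinorm_mul_le_dot {d : ℕ} {f : (Fin d → ℝ) → ℝ} (hf : ∀ x ∈ pos d, 0 ≤ f x)
    {p x : Fin d → ℝ} (hp : p ∈ pos d) (hx : x ∈ pos d) : dualAntinorm f p * f x ≤ dot p x := by
  have dot_nonneg : ∀ y ∈ pos d, 0 ≤ dot p y := fun y hy =>
    Finset.sum_nonneg fun i _ => mul_nonneg (hp i) (hy i)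
  rcases (hf x hx).eq_or_lt with h | h
  · rw [← h, mul_zero]
    exact dot_nonneg x hx
  · rw [← le_div_iff₀ h]
    refine csInf_le ⟨0, ?_⟩ ⟨x, ⟨hx, h.ne'⟩, rfl⟩
    rintro _ ⟨y, ⟨hy, -⟩, rfl⟩
    exact div_nonneg (dot_nonneg y hy) (hf y hy)

/-- A functional that is nonnegative on the orthant has a nonnegative dual there. -/
theorem dualAntinorm_nonneg {d : ℕ} {f : (Fin d → ℝ) → ℝ} (hf : ∀ x ∈ pos d, 0 ≤ f x)
    {p : Fin d → ℝ} (hp : p ∈ pos d) : 0 ≤ dualAntinorm f p := by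
  refine Real.sInf_nonneg ?_
  rintro _ ⟨y, ⟨hy, -⟩, rfl⟩
  exact div_nonneg (Finset.sum_nonneg fun i _ => mul_nonneg (hp i) (hy i)) (hf y hy)

/-- A linear functional dominating `f` has dual value at least one. -/
theorem one_le_dualAntinorm {d : ℕ} {f : (Fin d → ℝ) → ℝ} (hf : IsAntinorm f)
    {p : Fin d → ℝ} (hp : ∀ x ∈ pos d, f x ≤ dot p x) : 1 ≤ dualAntinorm f p := by
  obtain ⟨hf₀, -, -, z, hz, hfz⟩ := hf
  refine le_csInf ⟨_, z, ⟨hz, hfz.ne'⟩, rfl⟩ ?_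
  rintro _ ⟨y, ⟨hy, hfy⟩, rfl⟩
  have h : 0 < f y := (hf₀ y hy).lt_of_ne' hfy
  exact (one_le_div h).2 (hp y hy)

theorem isClosed_pos (d : ℕ) : IsClosed (pos d) := by
  simp only [pos, Set.ofPred_forall]
  exact isClosed_iInter fun i => isClosed_le continuous_const (continuous_apply i)

/-- A continuous linear functional on the product is given by coefficients. -/
theorem apply_prod_eq_mul_add_dot {d : ℕ} (g : StrongDual ℝ ((Fin d → ℝ) × ℝ))
    (y : Fin d → ℝ) (t : ℝ) :
    g (y, t) = g (0, 1) * t + dot (fun i => g (Pi.single i 1, 0)) y := by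
  have hsplit : (y, t) = t • ((0, 1) : (Fin d → ℝ) × ℝ) +
      ∑ i, y i • ((Pi.single i 1, 0) : (Fin d → ℝ) × ℝ) := by
    ext j
    · simp [Prod.fst_sum, Finset.sum_apply, Pi.single_apply]
    · simp [Prod.snd_sum]
  rw [hsplit, map_add, map_smul, map_sum]
  simp only [map_smul, smul_eq_mul, dot, mul_comm]

/-- A continuous antinorm is the pointwise infimum of the nonnegative linear functionals
dominating it. -/
theorem exists_dominating_dot_lt {d : ℕ} {f : (Fin d → ℝ) → ℝ} (hf : IsAntinorm f)
    (hfcont : ContinuousOn f (pos d)) {x : Fin d → ℝ} (hx : x ∈ pos d) {a : ℝ} (ha : f x < a) :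
    ∃ p ∈ pos d, (∀ y ∈ pos d, f y ≤ dot p y) ∧ dot p x < a := by
  obtain ⟨hf₀, hhom, hconc, -⟩ := hf
  have zero_mem : (0 : Fin d → ℝ) ∈ pos d := fun _ => le_rfl
  have map_zero' : f 0 = 0 := by simpa using hhom 0 zero_mem 0 le_rfl
  obtain ⟨g, u, hgu, hua⟩ := geometric_hahn_banach_closed_point hconc.convex_hypograph
    ((isClosed_pos d).hypograph hfcont) (x := (x, a)) (fun h => ha.not_ge h.2)
  have hu : 0 < u := by
    simpa only [Prod.mk_zero_zero, map_zero] using hgu (0, 0) ⟨zero_mem, map_zero'.ge⟩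
  have hg : ∀ y ∈ pos d, ∀ t ≤ f y, g (y, t) ≤ 0 := by
    intro y hy t ht
    by_contra! hpos
    have hl : 0 ≤ u / g (y, t) := by positivity
    have h := hgu ((u / g (y, t)) • (y, t)) ⟨fun i => mul_nonneg hl (hy i), by
      change u / g (y, t) * t ≤ f ((u / g (y, t)) • y)
      rw [hhom y hy _ hl]
      exact mul_le_mul_of_nonneg_left ht hl⟩
    rw [map_smul, smul_eq_mul, div_mul_cancel₀ _ hpos.ne'] at h
    exact h.false
  have hga := hu.trans hua
  set c := g (0, 1)
  set q : Fin d → ℝ := fun i => g (Pi.single i 1, 0)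
  have hq₀ : ∀ i, q i ≤ 0 := fun i => by
    have hi : Pi.single i (1 : ℝ) ∈ pos d := fun j => by
      by_cases h : j = i <;> simp [h]
    exact hg _ hi 0 (hf₀ _ hi)
  have hqx : dot q x ≤ 0 :=
    Finset.sum_nonpos fun i _ => mul_nonpos_of_nonpos_of_nonneg (hq₀ i) (hx i)
  rw [apply_prod_eq_mul_add_dot] at hga
  have hca : 0 < c * a := by linarith
  have hc₀ : 0 < c := pos_of_mul_pos_left hca ((hf₀ x hx).trans ha.le)
  have hdot : ∀ y, dot (fun i => -q i / c) y = -dot q y / c := fun y => by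
    simp only [dot, Finset.sum_div, ← Finset.sum_neg_distrib]
    exact Finset.sum_congr rfl fun i _ => by ring
  refine ⟨fun i => -q i / c, fun i => div_nonneg (neg_nonneg.2 (hq₀ i)) hc₀.le, ?_, ?_⟩
  · intro y hy
    have h := hg y hy (f y) le_rfl
    rw [apply_prod_eq_mul_add_dot] at h
    rw [hdot, le_div_iff₀ hc₀]
    linarith
  · rw [hdot, div_lt_iff₀ hc₀]
    linarith

/-- A continuous antinorm is reflexive: `f** = f` on `ℝ^d₊`. -/
theorem double_dual_eq_self_of_continuous (d : ℕ) (f : (Fin d → ℝ) → ℝ)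
    (hf : IsAntinorm f)
    (hfcont : ContinuousOn f (pos d)) :
    ∀ x ∈ pos d, dualAntinorm (dualAntinorm f) x = f x := by
  intro x hx
  have dot_comm : ∀ p : Fin d → ℝ, dot x p = dot p x := fun p =>
    Finset.sum_congr rfl fun i _ => mul_comm _ _
  have dual_nonneg : ∀ p ∈ pos d, 0 ≤ dualAntinorm f p := fun p hp =>
    dualAntinorm_nonneg hf.1 hp
  refine le_antisymm (le_of_forall_gt_imp_ge_of_dense fun a ha => ?_) ?_
  · obtain ⟨p, hp, hdom, hpa⟩ := exists_dominating_dot_lt hf hfcont hx ha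
    have hone := one_le_dualAntinorm hf hdom
    have hmul := dualAntinorm_mul_le_dot dual_nonneg hx hp
    rw [dot_comm] at hmul
    have := le_mul_of_one_le_right (dualAntinorm_nonneg dual_nonneg hx) hone
    linarith
  · obtain ⟨p, hp, hdom, -⟩ := exists_dominating_dot_lt hf hfcont hx (lt_add_one (f x))
    have hone := one_le_dualAntinorm hf hdom
    refine le_csInf ⟨_, p, ⟨hp, (zero_lt_one.trans_le hone).ne'⟩, rfl⟩ ?_
    rintro _ ⟨r, ⟨hr, hfr⟩, rfl⟩
    have hr₀ : 0 < dualAntinorm f r := (dual_nonneg r hr).lt_of_ne' hfr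
    change f x ≤ dot x r / dualAntinorm f r
    rw [le_div_iff₀ hr₀, dot_comm, mul_comm]
    exact dualAntinorm_mul_le_dot hf.1 hr hx
end
end

section
/- For every continuous antinorm f on ℝ^d₊ with unit antiball G = {x ∈ ℝ^d₊ : f(x) ≥ 1} and antipolar G* = {p ∈ ℝ^d₊ : ⟨p,x⟩ ≥ 1 for all x ∈ G}, the support-type function of G* recovers f: inf{⟨p,x⟩ : p ∈ G*} = f(x) for every x ∈ ℝ^d₊. In particular, G* is the unit antiball of the dual antinorm f*, i.e., G* = {p ∈ ℝ^d₊ : f*(p) ≥ 1}. -/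
open scoped BigOperators

noncomputable section

theorem dot_smul_right {d : ℕ} (p x : Fin d → ℝ) (l : ℝ) : dot p (l • x) = l * dot p x := by
  simp only [dot, Finset.mul_sum, Pi.smul_apply, smul_eq_mul]
  exact Finset.sum_congr rfl fun i _ => by ring

theorem dot_nonneg {d : ℕ} {p x : Fin d → ℝ} (hp : p ∈ pos d) (hx : x ∈ pos d) : 0 ≤ dot p x :=
  Finset.sum_nonneg fun i _ => mul_nonneg (hp i) (hx i)

theorem smul_mem_pos {d : ℕ} {x : Fin d → ℝ} (hx : x ∈ pos d) {l : ℝ} (hl : 0 ≤ l) :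
    l • x ∈ pos d :=
  fun i => mul_nonneg hl (hx i)

/-- The hypograph of a continuous function on the orthant is closed. -/
theorem isClosed_hypograph {d : ℕ} {f : (Fin d → ℝ) → ℝ} (hc : ContinuousOn f (pos d)) :
    IsClosed {z : (Fin d → ℝ) × ℝ | z.1 ∈ pos d ∧ z.2 ≤ f z.1} := by
  have hS : IsClosed {z : (Fin d → ℝ) × ℝ | z.1 ∈ pos d} :=
    (isClosed_pos d).preimage continuous_fst
  exact hS.isClosed_le continuousOn_snd (hc.comp continuousOn_fst fun z hz => hz)

/-- A linear functional on `ℝ^d × ℝ` in coordinates. -/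
theorem continuousLinearMap_prod_apply {d : ℕ} (φ : (Fin d → ℝ) × ℝ →L[ℝ] ℝ)
    (y : Fin d → ℝ) (t : ℝ) :
    φ (y, t) = dot (fun i => φ (Pi.single i 1, 0)) y + t * φ (0, 1) := by
  have h1 : (y, t) = (∑ i, y i • ((Pi.single i 1, 0) : (Fin d → ℝ) × ℝ)) + t • (0, 1) := by
    ext j
    · simp [Prod.fst_sum, Finset.sum_apply, Pi.single_apply]
    · simp [Prod.snd_sum]
  conv_lhs => rw [h1]
  simp only [map_add, map_sum, map_smul, smul_eq_mul, dot]
  congr 1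
  exact Finset.sum_congr rfl fun i _ => mul_comm _ _

/-- A continuous antinorm is approximated from above, at each point of the orthant, by
nonnegative linear functionals that dominate it. -/
theorem IsAntinorm.exists_dot_lt {d : ℕ} {f : (Fin d → ℝ) → ℝ} (hf : IsAntinorm f)
    (hc : ContinuousOn f (pos d)) {x : Fin d → ℝ} (hx : x ∈ pos d) {r : ℝ} (hr : f x < r) :
    ∃ p ∈ pos d, (∀ y ∈ pos d, f y ≤ dot p y) ∧ dot p x < r := by
  obtain ⟨hnonneg, hhom, hconc, -⟩ := hf
  obtain ⟨φ, u, hlt, hgt⟩ := geometric_hahn_banach_closed_point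
    hconc.convex_hypograph (isClosed_hypograph hc)
    (show (x, r) ∉ {z : (Fin d → ℝ) × ℝ | z.1 ∈ pos d ∧ z.2 ≤ f z.1} from
      fun h => hr.not_ge h.2)
  have h0 : (0 : Fin d → ℝ) ∈ pos d := fun i => le_rfl
  have hu : 0 < u := by
    have h := hlt 0 ⟨h0, hnonneg 0 h0⟩
    rwa [map_zero] at h
  have hle : ∀ y ∈ pos d, ∀ t ≤ f y, φ (y, t) ≤ 0 := by
    intro y hy t ht
    by_contra! hpos
    have hl : 0 ≤ u / φ (y, t) := by positivity
    have := hlt ((u / φ (y, t)) • (y, t)) ⟨smul_mem_pos hy hl, by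
      change u / φ (y, t) * t ≤ f ((u / φ (y, t)) • y)
      rw [hhom y hy _ hl]
      exact mul_le_mul_of_nonneg_left ht hl⟩
    rw [map_smul, smul_eq_mul, div_mul_cancel₀ _ hpos.ne'] at this
    exact this.false
  set q : Fin d → ℝ := fun i => φ (Pi.single i 1, 0) with hq
  set s := φ (0, 1) with hs
  have hφ : ∀ y t, φ (y, t) = dot q y + t * s := continuousLinearMap_prod_apply φ
  have hs0 : 0 < s := by
    have h1 := hle x hx (f x) le_rfl
    rw [hφ] at h1 hgt
    nlinarith
  have hdot : ∀ y, dot (-s⁻¹ • q) y = -(dot q y) / s := by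
    intro y
    simp only [dot, Pi.smul_apply, smul_eq_mul, ← Finset.sum_neg_distrib, Finset.sum_div]
    exact Finset.sum_congr rfl fun i _ => by field_simp
  have hdom : ∀ y ∈ pos d, f y ≤ dot (-s⁻¹ • q) y := by
    intro y hy
    have := hle y hy (f y) le_rfl
    rw [hφ] at this
    rw [hdot, le_div_iff₀ hs0]
    linarith
  refine ⟨-s⁻¹ • q, fun i => ?_, hdom, ?_⟩
  · have hi : (Pi.single i 1 : Fin d → ℝ) ∈ pos d := fun j => by
      by_cases h : j = i
      · subst h; simp
      · simp [h]
    simpa [dot, Pi.single_apply] using (hnonneg _ hi).trans (hdom _ hi)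
  · rw [hdot, div_lt_iff₀ hs0]
    rw [hφ] at hgt
    linarith

/-- A nonnegative vector lies in the antipolar of the unit antiball iff it dominates the
antinorm on the orthant. -/
theorem IsAntinorm.forall_one_le_dot_iff {d : ℕ} {f : (Fin d → ℝ) → ℝ} (hf : IsAntinorm f)
    {p : Fin d → ℝ} (hp : p ∈ pos d) :
    (∀ x ∈ {x | x ∈ pos d ∧ 1 ≤ f x}, 1 ≤ dot p x) ↔ ∀ x ∈ pos d, f x ≤ dot p x := by
  obtain ⟨hnonneg, hhom, -, -⟩ := hf
  refine ⟨fun h x hx => ?_, fun h x hx => hx.2.trans (h x hx.1)⟩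
  rcases (hnonneg x hx).eq_or_lt with h0 | h0
  · exact h0 ▸ dot_nonneg hp hx
  · have hl : 0 ≤ (f x)⁻¹ := by positivity
    have := h ((f x)⁻¹ • x) ⟨smul_mem_pos hx hl, by
      rw [hhom x hx _ hl, inv_mul_cancel₀ h0.ne']⟩
    rw [dot_smul_right, inv_mul_eq_div, le_div_iff₀ h0] at this
    linarith

/-- A nonnegative vector has dual antinorm at least one iff it dominates the antinorm on the
orthant. -/
theorem IsAntinorm.one_le_dualAntinorm_iff {d : ℕ} {f : (Fin d → ℝ) → ℝ} (hf : IsAntinorm f)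
    {p : Fin d → ℝ} (hp : p ∈ pos d) :
    1 ≤ dualAntinorm f p ↔ ∀ x ∈ pos d, f x ≤ dot p x := by
  obtain ⟨hnonneg, -, -, x₀, hx₀, hfx₀⟩ := hf
  have hbdd : BddBelow ((fun x => dot p x / f x) '' {x | x ∈ pos d ∧ f x ≠ 0}) := by
    refine ⟨0, ?_⟩
    rintro _ ⟨x, ⟨hx, -⟩, rfl⟩
    exact div_nonneg (dot_nonneg hp hx) (hnonneg x hx)
  have hne : ((fun x => dot p x / f x) '' {x | x ∈ pos d ∧ f x ≠ 0}).Nonempty :=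
    ⟨_, x₀, ⟨hx₀, hfx₀.ne'⟩, rfl⟩
  rw [dualAntinorm, le_csInf_iff hbdd hne]
  constructor
  · intro h x hx
    rcases (hnonneg x hx).eq_or_lt with h0 | h0
    · exact h0 ▸ dot_nonneg hp hx
    · simpa using (le_div_iff₀ h0).1 (h _ ⟨x, ⟨hx, h0.ne'⟩, rfl⟩)
  · rintro h _ ⟨x, ⟨hx, hfx⟩, rfl⟩
    exact (one_le_div ((hnonneg x hx).lt_of_ne' hfx)).2 (h x hx)

/-- For a continuous antinorm `f` on `ℝ^d₊` with unit antiball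
`G = {x ∈ ℝ^d₊ : f(x) ≥ 1}` and antipolar `G*`, the support-type function of `G*`
recovers `f`, and `G*` is the unit antiball of the dual antinorm `f*`. -/
theorem antipolar_support_function (d : ℕ)
    (f : (Fin d → ℝ) → ℝ)
    (hf : IsAntinorm f) (hc : ContinuousOn f (pos d))
    (G Gstar : Set (Fin d → ℝ))
    (hG : G = {x | x ∈ pos d ∧ 1 ≤ f x})
    (hGstar : Gstar = {p | p ∈ pos d ∧ ∀ x ∈ G, 1 ≤ dot p x}) :
    (∀ x ∈ pos d, sInf ((fun p => dot p x) '' Gstar) = f x) ∧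
    Gstar = {p | p ∈ pos d ∧ 1 ≤ dualAntinorm f p} := by
  subst hG hGstar
  have hset : {p | p ∈ pos d ∧ ∀ x ∈ {x | x ∈ pos d ∧ 1 ≤ f x}, 1 ≤ dot p x} =
      {p | p ∈ pos d ∧ ∀ x ∈ pos d, f x ≤ dot p x} :=
    Set.ext fun p => and_congr_right fun hp => hf.forall_one_le_dot_iff hp
  rw [hset]
  refine ⟨fun x hx => ?_,
    Set.ext fun p => and_congr_right fun hp => (hf.one_le_dualAntinorm_iff hp).symm⟩
  refine csInf_eq_of_forall_ge_of_forall_gt_exists_lt ?_ ?_ ?_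
  · obtain ⟨p, hp, hdom, -⟩ := hf.exists_dot_lt hc hx (lt_add_one (f x))
    exact ⟨_, p, ⟨hp, hdom⟩, rfl⟩
  · rintro _ ⟨p, ⟨-, hdom⟩, rfl⟩
    exact hdom x hx
  · intro r hr
    obtain ⟨p, hp, hdom, hlt⟩ := hf.exists_dot_lt hc hx hr
    exact ⟨_, ⟨p, ⟨hp, hdom⟩, rfl⟩, hlt⟩
end
end
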